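/- arXiv:2312.01156 — 4 statements merged into one kernel-verified Lean document; each statement's English description precedes it below -/
import Mathlib

section
/- Let n ≥ 1, let D ∈ {0,1}^{n×n} be a binary matrix, set m = ⌈log₂ n⌉ and r = (2^0, 2^1, …, 2^m)ᵀ ∈ ℕ^{m+1}, and let β ∈ ℝ with β > n. Suppose there exists a binary vector x₀ ∈ {0,1}^n with D x₀ ≥ 1 entrywise. Then for every minimizer (x*, S*) of the penalized objective F(x, S) = ∑_{i=1}^n x_i + β·‖Dx − 1 − S r‖² over x ∈ {0,1}^n and binary slack matrices S ∈ {0,1}^{n×(m+1)}: the constraint is satisfied exactly, i.e. D x* − 1 − S* r = 0, hence D x* ≥ 1 entrywise, and moreover ∑_i x*_i = min{∑_i x_i : x ∈ {0,1}^n, Dx ≥ 1}. -/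
open Finset

lemma bits_exist (M : ℕ) : ∀ N : ℕ, N < 2 ^ M → ∃ s : Fin M → ℝ,
    (∀ k, s k = 0 ∨ s k = 1) ∧ ∑ k, s k * (2 : ℝ) ^ (k : ℕ) = N := by
  induction M with
  | zero =>
    intro N hN
    have : N = 0 := by simpa using hN
    exact ⟨fun _ => 0, fun _ => Or.inl rfl, by simp [this]⟩
  | succ M ih =>
    intro N hN
    obtain ⟨s, hs, hsum⟩ := ih (N / 2) (by rw [pow_succ] at hN; omega)
    refine ⟨Fin.cons ((N % 2 : ℕ) : ℝ) s, ?_, ?_⟩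
    · intro k
      refine Fin.cases ?_ (fun k => ?_) k
      · rcases Nat.mod_two_eq_zero_or_one N with h | h <;> simp [h]
      · simpa using hs k
    · rw [Fin.sum_univ_succ]
      simp only [Fin.cons_zero, Fin.cons_succ, Fin.val_zero, Fin.val_succ, pow_zero, mul_one]
      have : ∑ k : Fin M, s k * (2 : ℝ) ^ ((k : ℕ) + 1) = 2 * ((N / 2 : ℕ) : ℝ) := by
        rw [← hsum, Finset.mul_sum]
        exact Finset.sum_congr rfl fun k _ => by ring
      rw [this]
      exact_mod_cast Nat.mod_add_div N 2

lemma binary_nat {a : ℝ} (h : a = 0 ∨ a = 1) : ∃ b : ℕ, b ≤ 1 ∧ a = b := by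
  rcases h with h | h
  · exact ⟨0, by simp, by simp [h]⟩
  · exact ⟨1, by simp, by simp [h]⟩

lemma row_nat {n : ℕ} (d x : Fin n → ℝ) (hd : ∀ j, d j = 0 ∨ d j = 1)
    (hx : ∀ j, x j = 0 ∨ x j = 1) : ∃ N : ℕ, N ≤ n ∧ ∑ j, d j * x j = N := by
  choose a ha hda using fun j => binary_nat (hd j)
  choose b hb hxb using fun j => binary_nat (hx j)
  refine ⟨∑ j, a j * b j, ?_, by simp [hda, hxb]⟩
  calc ∑ j, a j * b j ≤ ∑ _j : Fin n, 1 :=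
        Finset.sum_le_sum fun j _ => by simpa using Nat.mul_le_mul (ha j) (hb j)
    _ = n := by simp

/-- Exactness of the binary-slack penalty reformulation (equation (11) of the paper):
with `m = ⌈log₂ n⌉`, powers-of-two vector `r_k = 2^k` (`k = 0,…,m`) and penalty
weight `β > n`, if some binary `x₀` satisfies `D x₀ ≥ 1` entrywise, then every
minimizer `(x*, S*)` of `F(x,S) = ∑ i, x i + β ‖Dx - 1 - S r‖²` over binary `x`
and binary slack matrices `S` satisfies the constraint exactly, is feasible, and
attains the minimum torch count. -/
theorem slack_penalty_exactness
    (n : ℕ) (hn : 1 ≤ n)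
    (D : Matrix (Fin n) (Fin n) ℝ) (hD : ∀ i j, D i j = 0 ∨ D i j = 1)
    (m : ℕ) (hm : m = Nat.clog 2 n)
    (β : ℝ) (hβ : (n : ℝ) < β)
    (x₀ : Fin n → ℝ) (hx₀ : ∀ j, x₀ j = 0 ∨ x₀ j = 1)
    (hfeas : ∀ i, 1 ≤ ∑ j, D i j * x₀ j)
    (F : (Fin n → ℝ) → Matrix (Fin n) (Fin (m + 1)) ℝ → ℝ)
    (hF : ∀ x S, F x S = (∑ i, x i) +
      β * ∑ i, (∑ j, D i j * x j - 1 - ∑ k, S i k * (2 : ℝ) ^ (k : ℕ)) ^ 2)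
    (xs : Fin n → ℝ) (Ss : Matrix (Fin n) (Fin (m + 1)) ℝ)
    (hxs : ∀ j, xs j = 0 ∨ xs j = 1) (hSs : ∀ i k, Ss i k = 0 ∨ Ss i k = 1)
    (hmin : ∀ (x : Fin n → ℝ) (S : Matrix (Fin n) (Fin (m + 1)) ℝ),
      (∀ j, x j = 0 ∨ x j = 1) → (∀ i k, S i k = 0 ∨ S i k = 1) →
      F xs Ss ≤ F x S) :
    (∀ i, ∑ j, D i j * xs j - 1 - ∑ k, Ss i k * (2 : ℝ) ^ (k : ℕ) = 0) ∧
    (∀ i, 1 ≤ ∑ j, D i j * xs j) ∧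
    (∀ x : Fin n → ℝ, (∀ j, x j = 0 ∨ x j = 1) →
      (∀ i, 1 ≤ ∑ j, D i j * x j) → ∑ i, xs i ≤ ∑ i, x i) := by
  have key : ∀ x : Fin n → ℝ, (∀ j, x j = 0 ∨ x j = 1) →
      (∀ i, 1 ≤ ∑ j, D i j * x j) → F xs Ss ≤ ∑ i, x i := by
    intro x hx hf
    have hrow : ∀ i, ∃ s : Fin (m + 1) → ℝ, (∀ k, s k = 0 ∨ s k = 1) ∧
        ∑ k, s k * (2 : ℝ) ^ (k : ℕ) = ∑ j, D i j * x j - 1 := by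
      intro i
      obtain ⟨N, hN, hs⟩ := row_nat (D i) x (hD i) hx
      have h1 : 1 ≤ N := by
        have := hf i
        rw [hs] at this
        exact_mod_cast this
      have hle : n ≤ 2 ^ m := by rw [hm]; exact Nat.le_pow_clog (by norm_num) n
      obtain ⟨s, hsb, hss⟩ := bits_exist (m + 1) (N - 1) (by rw [pow_succ]; omega)
      exact ⟨s, hsb, by rw [hss, hs]; push_cast [h1]; ring⟩
    choose S hSb hS using hrow
    have h := hmin x S hx hSb
    have h0 : F x S = ∑ i, x i := by
      refine (hF x S).trans ?_
      simp [hS]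
    rwa [h0] at h
  have hβ0 : 0 < β := lt_of_le_of_lt (Nat.cast_nonneg n) hβ
  have hxs0 : 0 ≤ ∑ i, xs i := Finset.sum_nonneg fun i _ => by
    rcases hxs i with h | h <;> simp [h]
  have hx0n : ∑ i, x₀ i ≤ n := by
    calc ∑ i, x₀ i ≤ ∑ _i : Fin n, (1 : ℝ) := Finset.sum_le_sum fun i _ => by
          rcases hx₀ i with h | h <;> simp [h]
      _ = n := by simp
  have hzero : ∀ i, ∑ j, D i j * xs j - 1 - ∑ k, Ss i k * (2 : ℝ) ^ (k : ℕ) = 0 := by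
    intro i
    by_contra hne
    obtain ⟨N, _, hN⟩ := row_nat (D i) xs (hD i) hxs
    choose b _ hb using fun k => binary_nat (hSs i k)
    have hint : ∑ j, D i j * xs j - 1 - ∑ k, Ss i k * (2 : ℝ) ^ (k : ℕ)
        = (((N : ℤ) - 1 - ∑ k, (b k : ℤ) * 2 ^ (k : ℕ) : ℤ) : ℝ) := by
      rw [hN]; push_cast; simp [hb]
    have hsq : (1 : ℝ) ≤
        (∑ j, D i j * xs j - 1 - ∑ k, Ss i k * (2 : ℝ) ^ (k : ℕ)) ^ 2 := by
      rw [hint] at hne ⊢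
      generalize ((N : ℤ) - 1 - ∑ k, (b k : ℤ) * 2 ^ (k : ℕ) : ℤ) = z at hne ⊢
      have hz : z ≠ 0 := by exact_mod_cast hne
      have : 0 < z ^ 2 := by positivity
      exact_mod_cast this
    have htot := Finset.single_le_sum
      (f := fun i => (∑ j, D i j * xs j - 1 - ∑ k, Ss i k * (2 : ℝ) ^ (k : ℕ)) ^ 2)
      (fun i _ => sq_nonneg _) (Finset.mem_univ i)
    have h := key x₀ hx₀ hfeas
    rw [hF] at h
    have := mul_le_mul_of_nonneg_left (hsq.trans htot) hβ0.le
    linarith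
  refine ⟨hzero, fun i => ?_, fun x hx hf => ?_⟩
  · have : 0 ≤ ∑ k, Ss i k * (2 : ℝ) ^ (k : ℕ) := Finset.sum_nonneg fun k _ => by
      rcases hSs i k with h | h <;> simp [h]
    linarith [hzero i]
  · have h := key x hx hf
    rw [hF] at h
    simpa [hzero] using h
end

section
/- Let n ≥ 1, let D ∈ {0,1}^{n×n} be a binary matrix, and let γ ∈ ℝ with γ > n. Define Θ(z) = ([z_1 < 0], …, [z_n < 0]) for z ∈ ℤ^n. Suppose there exists a binary vector x₀ ∈ {0,1}^n with D x₀ ≥ 1 entrywise. Then for every pair (x*, z*) with x* ∈ {0,1}^n and z* ∈ ℤ^n minimizing the objective ∑_{i=1}^n x_i + γ·∑_{i=1}^n Θ(z)_i subject to the constraint Dx − 1 − z = 0: it holds that z* ≥ 0 entrywise (so D x* ≥ 1 entrywise), and ∑_i x*_i = min{∑_i x_i : x ∈ {0,1}^n, Dx ≥ 1}. -/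
open Finset

/-- Exactness of the step-function reformulation (equations (14)-(15) of the paper):
with penalty weight `γ > n` and `Θ(z)_i = [z_i < 0]`, if some binary `x₀` satisfies
`D x₀ ≥ 1` entrywise, then every minimizer `(x*, z*)` of
`∑ i, x i + γ ∑ i, Θ(z)_i` over binary `x` and integer `z` subject to
`Dx - 1 - z = 0` satisfies `z* ≥ 0` entrywise (hence `D x* ≥ 1` entrywise) and
attains the minimum torch count of the original problem. -/
theorem theta_penalty_exactness
    (n : ℕ) (hn : 1 ≤ n)
    (D : Matrix (Fin n) (Fin n) ℝ) (hD : ∀ i j, D i j = 0 ∨ D i j = 1)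
    (γ : ℝ) (hγ : (n : ℝ) < γ)
    (x₀ : Fin n → ℝ) (hx₀ : ∀ j, x₀ j = 0 ∨ x₀ j = 1)
    (hfeas : ∀ i, 1 ≤ ∑ j, D i j * x₀ j)
    (xs : Fin n → ℝ) (zs : Fin n → ℤ)
    (hxs : ∀ j, xs j = 0 ∨ xs j = 1)
    (hconstr : ∀ i, ∑ j, D i j * xs j - 1 - (zs i : ℝ) = 0)
    (hmin : ∀ (x : Fin n → ℝ) (z : Fin n → ℤ),
      (∀ j, x j = 0 ∨ x j = 1) →
      (∀ i, ∑ j, D i j * x j - 1 - (z i : ℝ) = 0) →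
      (∑ i, xs i) + γ * (∑ i, if zs i < 0 then (1 : ℝ) else 0) ≤
        (∑ i, x i) + γ * (∑ i, if z i < 0 then (1 : ℝ) else 0)) :
    (∀ i, 0 ≤ zs i) ∧
    (∀ i, 1 ≤ ∑ j, D i j * xs j) ∧
    (∀ x : Fin n → ℝ, (∀ j, x j = 0 ∨ x j = 1) →
      (∀ i, 1 ≤ ∑ j, D i j * x j) → ∑ i, xs i ≤ ∑ i, x i) := by
  have key : ∀ x : Fin n → ℝ, (∀ j, x j = 0 ∨ x j = 1) →
      (∀ i, 1 ≤ ∑ j, D i j * x j) →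
      (∑ i, xs i) + γ * (∑ i, if zs i < 0 then (1 : ℝ) else 0) ≤ ∑ i, x i := by
    intro x hx hf
    have hint : ∀ i j, ∃ m : ℤ, D i j * x j = (m : ℝ) := by
      intro i j
      rcases hD i j with h | h <;> rcases hx j with h' | h'
      · exact ⟨0, by simp [h]⟩
      · exact ⟨0, by simp [h]⟩
      · exact ⟨0, by simp [h']⟩
      · exact ⟨1, by simp [h, h']⟩
    choose m hm using hint
    have hz : ∀ i, ∑ j, D i j * x j = ((∑ j, m i j : ℤ) : ℝ) := by
      intro i
      push_cast
      exact Finset.sum_congr rfl (fun j _ => hm i j)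
    have h := hmin x (fun i => ∑ j, m i j - 1) hx (by
      intro i
      rw [hz i]
      push_cast
      ring)
    have hnn : ∀ i, ¬ (∑ j, m i j - 1 < 0) := by
      intro i
      have h1 := hf i
      rw [hz i] at h1
      have h2 : (1 : ℤ) ≤ ∑ j, m i j := by exact_mod_cast h1
      omega
    simpa [hnn] using h
  have hγ0 : 0 < γ := lt_of_le_of_lt (Nat.cast_nonneg n) hγ
  have hxs0 : 0 ≤ ∑ i, xs i := Finset.sum_nonneg (fun i _ => by
    rcases hxs i with h | h <;> simp [h])
  have hx₀n : ∑ i, x₀ i ≤ (n : ℝ) := by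
    have : ∑ i, x₀ i ≤ ∑ _i : Fin n, (1 : ℝ) := Finset.sum_le_sum (fun i _ => by
      rcases hx₀ i with h | h <;> simp [h])
    simpa using this
  have hpos : ∀ i ∈ (Finset.univ : Finset (Fin n)),
      (0 : ℝ) ≤ if zs i < 0 then (1 : ℝ) else 0 := by
    intro i _
    split_ifs <;> norm_num
  have hzs : ∀ i, 0 ≤ zs i := by
    intro i
    by_contra hneg
    have hlt : zs i < 0 := not_le.mp hneg
    have h1 := Finset.single_le_sum hpos (Finset.mem_univ i)
    rw [if_pos hlt] at h1
    have h2 := key x₀ hx₀ hfeas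
    have h3 := mul_le_mul_of_nonneg_left h1 hγ0.le
    linarith
  refine ⟨hzs, ?_, ?_⟩
  · intro i
    have h1 := hconstr i
    have h2 : (0 : ℝ) ≤ (zs i : ℝ) := by exact_mod_cast hzs i
    linarith
  · intro x hx hf
    have h1 := key x hx hf
    have h2 := mul_nonneg hγ0.le (Finset.sum_nonneg hpos)
    linarith
end

section
/- Let n ≥ 1, D ∈ {0,1}^{n×n} a binary matrix, x ∈ {0,1}^n a binary vector, and set c = Dx − 1 ∈ ℤ^n (so c_i ≥ −1 for all i). Let μ > 0 and γ ≥ μ/2 be reals, and define Θ(z) = ([z_1 < 0], …, [z_n < 0]) for z ∈ ℤ^n. Then the vector z* = max{0, Dx − 1} (maximum taken entrywise) minimizes the function g(z) = γ·∑_{i=1}^n Θ(z)_i + (μ/2)·‖Dx − 1 − z‖² over all z ∈ ℤ^n. -/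
open Finset

/-- Closed form of the ADMM `z`-update: with `D` and `x` binary (so every entry of
`Dx - 1` is an integer `≥ -1`), `μ > 0` and `γ ≥ μ/2`, the entrywise clamp
`z* = max {0, Dx - 1}` minimizes
`g(z) = γ ∑ i, [z_i < 0] + (μ/2) ‖Dx - 1 - z‖²` over all `z ∈ ℤⁿ`. -/
theorem z_update_closed_form
    (n : ℕ) (hn : 1 ≤ n)
    (D : Matrix (Fin n) (Fin n) ℤ) (hD : ∀ i j, D i j = 0 ∨ D i j = 1)
    (x : Fin n → ℤ) (hx : ∀ j, x j = 0 ∨ x j = 1)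
    (μ γ : ℝ) (hμ : 0 < μ) (hγ : μ / 2 ≤ γ)
    (g : (Fin n → ℤ) → ℝ)
    (hg : ∀ z : Fin n → ℤ, g z =
      γ * (∑ i, if z i < 0 then (1 : ℝ) else 0) +
        (μ / 2) * ∑ i, ((((∑ j, D i j * x j) - 1 - z i : ℤ) : ℝ)) ^ 2)
    (zstar : Fin n → ℤ)
    (hzstar : ∀ i, zstar i = max 0 ((∑ j, D i j * x j) - 1)) :
    ∀ z : Fin n → ℤ, g zstar ≤ g z := by
  intro z
  rw [hg, hg, Finset.mul_sum, Finset.mul_sum, Finset.mul_sum, Finset.mul_sum,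
    ← Finset.sum_add_distrib, ← Finset.sum_add_distrib]
  refine Finset.sum_le_sum fun i _ => ?_
  have hs : 0 ≤ ∑ j, D i j * x j := by
    refine Finset.sum_nonneg fun j _ => ?_
    rcases hD i j with h | h <;> rcases hx j with h' | h' <;> simp [h, h']
  rw [hzstar i]
  generalize (∑ j, D i j * x j) = s at hs
  generalize z i = w
  have hnot : ¬ (max 0 (s - 1) < 0) := not_lt.mpr (le_max_left _ _)
  rw [if_neg hnot]
  have hsq : 0 ≤ μ / 2 * (((s - 1 - w : ℤ) : ℝ)) ^ 2 := by positivity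
  have hγ0 : 0 < γ := by linarith
  rcases hs.eq_or_lt with h0 | h0
  · subst h0
    have hm : max (0 : ℤ) (0 - 1) = 0 := by norm_num
    rw [hm]
    by_cases hw : w < 0
    · rw [if_pos hw]
      push_cast at hsq ⊢
      linarith
    · rw [if_neg hw]
      have hw' : (0 : ℝ) ≤ (w : ℝ) := by exact_mod_cast not_lt.mp hw
      have h1 : (1 : ℝ) ≤ (0 - 1 - (w : ℝ)) ^ 2 := by nlinarith
      push_cast
      nlinarith
  · have hm : max 0 (s - 1) = s - 1 := max_eq_right (by omega)
    rw [hm]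
    have h2 : 0 ≤ γ * (if w < 0 then (1 : ℝ) else 0) := by
      split_ifs <;> simp [hγ0.le]
    simp only [sub_self, Int.cast_zero]
    linarith
end

section
/- Let n ≥ 1, let S_1, …, S_n be an enumeration of a finite tile set S, let d : S → S → ℕ∞ be a distance function with d(s,s) = 0 for all s, and let L_torch, L_min ∈ ℕ with 1 ≤ L_min ≤ L_torch. Define the binary matrix D ∈ {0,1}^{n×n} by D_{ij} = 1 if d(S_i, S_j) ≤ L_torch − L_min and D_{ij} = 0 otherwise, and for a finite T ⊆ S define the light level l(s | T) = max over t ∈ T of the truncated difference (L_torch − d(s,t)) (equal to 0 whenever d(s,t) ≥ L_torch, and l(s | ∅) = 0). Then the minimum of |T| over all subsets T ⊆ S satisfying l(s | T) ≥ L_min for all s ∈ S equals the minimum of ∑_{i=1}^n x_i over all binary vectors x ∈ {0,1}^n satisfying ∑_{j=1}^n D_{ij} x_j ≥ 1 for all i ∈ [n]; both minima are attained, and the correspondence T ↔ x with x_j = 1 iff S_j ∈ T maps optimal solutions of one problem to optimal solutions of the other. -/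
open Finset

/-- The overall reduction of TorchPlacement to the binary integer program
`min {1ᵀx : x ∈ {0,1}ⁿ, Dx ≥ 1}`: with tiles enumerated by `e : Fin n ≃ α`,
distance `d` satisfying `d s s = 0`, `1 ≤ L_min ≤ L_torch`, light level
`l(s | T) = max_{t ∈ T} (L_torch - d(s,t))` (truncated subtraction in `ℕ∞`), and
`D i j = [d(S_i, S_j) ≤ L_torch - L_min]`, the two minima are attained and equal,
and the indicator correspondence `T ↔ x` (with `x_j = 1` iff `S_j ∈ T`) maps
optimal solutions of either problem to optimal solutions of the other. -/
theorem torchplacement_equals_integer_program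
    {α : Type*} [Fintype α] [DecidableEq α]
    (n : ℕ) (hn : 1 ≤ n) (e : Fin n ≃ α)
    (d : α → α → ℕ∞) (hd : ∀ s, d s s = 0)
    (Ltorch Lmin : ℕ) (h1 : 1 ≤ Lmin) (h2 : Lmin ≤ Ltorch)
    (D : Matrix (Fin n) (Fin n) ℕ)
    (hD : ∀ i j, D i j = if d (e i) (e j) ≤ ((Ltorch - Lmin : ℕ) : ℕ∞) then 1 else 0)
    (lit : Finset α → Prop)
    (hlit : ∀ T : Finset α, lit T ↔
      ∀ s : α, (Lmin : ℕ∞) ≤ T.sup fun t => (Ltorch : ℕ∞) - d s t)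
    (feas : (Fin n → ℕ) → Prop)
    (hfeas : ∀ x : Fin n → ℕ, feas x ↔
      (∀ j, x j = 0 ∨ x j = 1) ∧ ∀ i, 1 ≤ ∑ j, D i j * x j) :
    (∃ T : Finset α, lit T ∧ ∀ T' : Finset α, lit T' → T.card ≤ T'.card) ∧
    (∃ x : Fin n → ℕ, feas x ∧ ∀ y : Fin n → ℕ, feas y → ∑ i, x i ≤ ∑ i, y i) ∧
    (∀ (T : Finset α) (x : Fin n → ℕ),
      lit T → (∀ T' : Finset α, lit T' → T.card ≤ T'.card) →
      feas x → (∀ y : Fin n → ℕ, feas y → ∑ i, x i ≤ ∑ i, y i) →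
      T.card = ∑ i, x i) ∧
    (∀ T : Finset α, lit T → (∀ T' : Finset α, lit T' → T.card ≤ T'.card) →
      feas (fun j => if e j ∈ T then 1 else 0) ∧
      ∀ y : Fin n → ℕ, feas y →
        (∑ j, if e j ∈ T then (1 : ℕ) else 0) ≤ ∑ i, y i) ∧
    (∀ x : Fin n → ℕ, feas x → (∀ y : Fin n → ℕ, feas y → ∑ i, x i ≤ ∑ i, y i) →
      lit (Finset.univ.filter fun s => x (e.symm s) = 1) ∧
      ∀ T' : Finset α, lit T' →
        (Finset.univ.filter fun s => x (e.symm s) = 1).card ≤ T'.card) := by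
  have key : ∀ s t, (Lmin : ℕ∞) ≤ (Ltorch : ℕ∞) - d s t ↔
      d s t ≤ ((Ltorch - Lmin : ℕ) : ℕ∞) := by
    intro s t
    generalize d s t = a
    induction a using ENat.recTopCoe with
    | top =>
      simp
      omega
    | coe a =>
      norm_cast
      omega
  have hL : ∀ T, lit T ↔ ∀ s, ∃ t ∈ T, d s t ≤ ((Ltorch - Lmin : ℕ) : ℕ∞) := by
    intro T
    rw [hlit]
    have hb : (⊥ : ℕ∞) < (Lmin : ℕ∞) := by
      rw [bot_eq_zero]
      exact_mod_cast h1
    simp only [Finset.le_sup_iff hb, key]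
  have hF : ∀ x, feas x ↔ (∀ j, x j = 0 ∨ x j = 1) ∧
      ∀ i, ∃ j, d (e i) (e j) ≤ ((Ltorch - Lmin : ℕ) : ℕ∞) ∧ x j ≠ 0 := by
    intro x
    rw [hfeas]
    refine and_congr_right fun _ => forall_congr' fun i => ?_
    rw [Nat.one_le_iff_ne_zero, Ne, Finset.sum_eq_zero_iff]
    push Not
    refine exists_congr fun j => ?_
    rw [hD]
    split_ifs with h <;> simp only [h] <;> simp
  have toF : ∀ T, lit T → feas (fun j => if e j ∈ T then 1 else 0) := by
    intro T hT
    rw [hF]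
    refine ⟨fun j => by by_cases h : e j ∈ T <;> simp [h], fun i => ?_⟩
    obtain ⟨t, ht, h⟩ := (hL T).1 hT (e i)
    exact ⟨e.symm t, by simpa using h, by simpa using ht⟩
  have toL : ∀ x, feas x → lit (Finset.univ.filter fun s => x (e.symm s) = 1) := by
    intro x hx
    rw [hF] at hx
    rw [hL]
    intro s
    obtain ⟨j, h, hj⟩ := hx.2 (e.symm s)
    refine ⟨e j, ?_, by simpa using h⟩
    have := hx.1 j
    simp
    omega
  have cF : ∀ T : Finset α, (∑ j, if e j ∈ T then (1 : ℕ) else 0) = T.card := by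
    intro T
    rw [Equiv.sum_comp e (fun s => if s ∈ T then (1 : ℕ) else 0)]
    simp
  have cL : ∀ x, feas x →
      (Finset.univ.filter fun s => x (e.symm s) = 1).card = ∑ i, x i := by
    intro x hx
    rw [Finset.card_filter, Equiv.sum_comp e.symm (fun i => if x i = 1 then 1 else 0)]
    refine Finset.sum_congr rfl fun i _ => ?_
    rcases ((hF x).1 hx).1 i with h | h <;> simp [h]
  have hU : lit Finset.univ := by
    rw [hL]
    exact fun s => ⟨s, Finset.mem_univ _, by simp [hd]⟩
  have P4 : ∀ T : Finset α, lit T → (∀ T' : Finset α, lit T' → T.card ≤ T'.card) →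
      feas (fun j => if e j ∈ T then 1 else 0) ∧
      ∀ y : Fin n → ℕ, feas y →
        (∑ j, if e j ∈ T then (1 : ℕ) else 0) ≤ ∑ i, y i := by
    intro T hT hm
    refine ⟨toF T hT, fun y hy => ?_⟩
    rw [cF, ← cL y hy]
    exact hm _ (toL y hy)
  have P1 : ∃ T : Finset α, lit T ∧ ∀ T' : Finset α, lit T' → T.card ≤ T'.card := by
    classical
    obtain ⟨T, hT, hm⟩ := Finset.exists_min_image (Finset.univ.filter lit) Finset.card
      ⟨Finset.univ, by simpa using hU⟩
    exact ⟨T, by simpa using hT, fun T' h => hm T' (by simpa using h)⟩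
  refine ⟨P1, ?_, ?_, P4, ?_⟩
  · obtain ⟨T, hT, hm⟩ := P1
    exact ⟨_, P4 T hT hm⟩
  · intro T x hT hm hx hmx
    apply le_antisymm
    · rw [← cL x hx]
      exact hm _ (toL x hx)
    · rw [← cF T]
      exact hmx _ (toF T hT)
  · intro x hx hmx
    refine ⟨toL x hx, fun T' hT' => ?_⟩
    rw [cL x hx, ← cF T']
    exact hmx _ (toF T' hT')
end
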